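/- arXiv:1310.8516 — 12 statements merged into one kernel-verified Lean document; each statement's English description precedes it below -/
import Mathlib

section
/- Let k be a positive integer, let q be an integer coprime to 2k with k + q > 0, and let i be an integer with −k ≤ i < k + q. Then g(2k+2q, q, i) = g(2k, q, i) + 1/2. -/
/-- `g (2k, q, i) = (2k-1)/2 - (1/k) * ∑_{j=0}^{k-1} [i + q j]`, where `[m]` is the
least nonnegative residue of `m` modulo `2k` (here `Int.emod` with positive modulus). -/
def g (k q i : ℤ) : ℚ :=
  (2 * (k : ℚ) - 1) / 2 -
    1 / (k : ℚ) * ∑ j ∈ Finset.range k.toNat, (((i + q * (j : ℤ)) % (2 * k) : ℤ) : ℚ)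

lemma floor_aux (D x : ℤ) (hD : 0 < D) (hx : -D ≤ x) (N : ℕ) :
    ∑ m ∈ Finset.range N, (if D * (m : ℤ) ≤ x then (1 : ℤ) else 0) = min (N : ℤ) (x / D + 1) := by
  have h1 : -1 ≤ x / D := by
    rw [Int.le_ediv_iff_mul_le hD]; linarith
  induction N with
  | zero => simp; omega
  | succ N ih =>
    rw [Finset.sum_range_succ, ih]
    have h2 : D * (N : ℤ) ≤ x ↔ (N : ℤ) ≤ x / D := by
      rw [Int.le_ediv_iff_mul_le hD, mul_comm]
    simp only [h2]
    push_cast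
    split_ifs <;> omega

lemma floor_aux' (D x : ℤ) (hD : 0 < D) (hx : -D ≤ x) (N : ℕ) (hN : x < N * D) :
    x / D = ∑ m ∈ Finset.range N, (if D * (m : ℤ) ≤ x then (1 : ℤ) else 0) - 1 := by
  rw [floor_aux D x hD hx N]
  have := Int.ediv_lt_of_lt_mul hD hN
  omega

lemma count_aux (k n m : ℕ) (i : ℤ) (hm : m ≤ n) (hi1 : -(k : ℤ) ≤ i)
    (hi2 : i < k + (2 * n + 1)) :
    ∑ j ∈ Finset.range (k + (2 * n + 1)),
      (if 2 * ((k : ℤ) + (2 * n + 1)) * m ≤ i + (2 * n + 1) * (j : ℤ) then (1 : ℤ) else 0)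
    = ∑ j ∈ Finset.range k,
      (if 2 * (k : ℤ) * m ≤ i + (2 * n + 1) * (j : ℤ) then (1 : ℤ) else 0)
      + (2 * n + 1 - 2 * m) := by
  obtain ⟨d, rfl⟩ := Nat.exists_eq_add_of_le hm
  have e : k + (2 * (m + d) + 1) = 2 * m + (k + (2 * d + 1)) := by ring
  rw [e, Finset.sum_range_add, Finset.sum_range_add]
  have z : ∑ j ∈ Finset.range (2 * m),
      (if 2 * ((k : ℤ) + (2 * (m + d : ℕ) + 1)) * m ≤ i + (2 * (m + d : ℕ) + 1) * (j : ℤ)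
        then (1 : ℤ) else 0) = 0 := by
    apply Finset.sum_eq_zero
    intro j hj
    rw [Finset.mem_range] at hj
    rw [if_neg]
    push_cast at *
    have h1 : (1 : ℤ) ≤ m := by omega
    have h2 : (j : ℤ) + 1 ≤ 2 * m := by omega
    nlinarith [mul_le_mul_of_nonneg_left h2 (by positivity : (0 : ℤ) ≤ 2 * (m + d) + 1),
      mul_le_mul_of_nonneg_left h1 (by positivity : (0 : ℤ) ≤ (k : ℤ))]
  have o : ∑ j ∈ Finset.range (2 * d + 1),
      (if 2 * ((k : ℤ) + (2 * (m + d : ℕ) + 1)) * m ≤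
        i + (2 * (m + d : ℕ) + 1) * ((2 * m + (k + j) : ℕ) : ℤ)
        then (1 : ℤ) else 0) = 2 * d + 1 := by
    rw [Finset.sum_congr rfl (g := fun _ => (1 : ℤ))]
    · simp
    · intro j hj
      rw [if_pos]
      push_cast at *
      have : (0 : ℤ) ≤ k * d := by positivity
      have : (0 : ℤ) ≤ (2 * (m + d) + 1) * j := by positivity
      nlinarith
  rw [z, o]
  have c : ∀ j : ℕ, (2 * ((k : ℤ) + (2 * (m + d : ℕ) + 1)) * m ≤
        i + (2 * (m + d : ℕ) + 1) * ((2 * m + j : ℕ) : ℤ)) ↔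
        2 * (k : ℤ) * m ≤ i + (2 * (m + d : ℕ) + 1) * (j : ℤ) := by
    intro j
    push_cast
    constructor <;> intro h <;> linarith
  simp only [c]
  push_cast
  ring

lemma sum_floor (k n : ℕ) (i : ℤ) (hk : 0 < k) (hi1 : -(k : ℤ) ≤ i)
    (hi2 : i < k + (2 * n + 1)) :
    ∑ j ∈ Finset.range (k + (2 * n + 1)),
      (i + (2 * n + 1) * (j : ℤ)) / (2 * ((k : ℤ) + (2 * n + 1)))
    = ∑ j ∈ Finset.range k, (i + (2 * n + 1) * (j : ℤ)) / (2 * (k : ℤ)) + n ^ 2 := by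
  have hk' : (0 : ℤ) < k := by exact_mod_cast hk
  have A : ∀ j ∈ Finset.range (k + (2 * n + 1)),
      (i + (2 * n + 1) * (j : ℤ)) / (2 * ((k : ℤ) + (2 * n + 1))) =
      ∑ m ∈ Finset.range (n + 1), (if 2 * ((k : ℤ) + (2 * n + 1)) * (m : ℤ) ≤
        i + (2 * n + 1) * (j : ℤ) then (1 : ℤ) else 0) - 1 := by
    intro j hj
    rw [Finset.mem_range] at hj
    have h2 : (j : ℤ) + 1 ≤ k + (2 * n + 1) := by omega
    have := mul_le_mul_of_nonneg_left h2 (by positivity : (0 : ℤ) ≤ 2 * n + 1)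
    have : (0 : ℤ) ≤ (2 * n + 1) * j := by positivity
    apply floor_aux' _ _ (by positivity)
    · linarith
    · push_cast; nlinarith
  have B : ∀ j ∈ Finset.range k,
      (i + (2 * n + 1) * (j : ℤ)) / (2 * (k : ℤ)) =
      ∑ m ∈ Finset.range (n + 1), (if 2 * (k : ℤ) * (m : ℤ) ≤
        i + (2 * n + 1) * (j : ℤ) then (1 : ℤ) else 0) - 1 := by
    intro j hj
    rw [Finset.mem_range] at hj
    have h2 : (j : ℤ) + 1 ≤ k := by omega
    have := mul_le_mul_of_nonneg_left h2 (by positivity : (0 : ℤ) ≤ 2 * n + 1)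
    have : (0 : ℤ) ≤ (2 * n + 1) * j := by positivity
    apply floor_aux' _ _ (by positivity)
    · linarith
    · push_cast; nlinarith
  rw [Finset.sum_congr rfl A, Finset.sum_congr rfl B, Finset.sum_sub_distrib,
    Finset.sum_sub_distrib, Finset.sum_comm, Finset.sum_comm (s := Finset.range k)]
  rw [Finset.sum_congr rfl (fun m hm => count_aux k n m i
    (by rw [Finset.mem_range] at hm; omega) hi1 hi2), Finset.sum_add_distrib]
  have S : ∀ N : ℕ, ∑ m ∈ Finset.range N, ((2 * n + 1 : ℤ) - 2 * m) = N * (2 * n + 2 - N) := by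
    intro N
    induction N with
    | zero => simp
    | succ N ih => rw [Finset.sum_range_succ, ih]; push_cast; ring
  rw [S]
  simp
  ring

lemma g_eq (k : ℕ) (q i : ℤ) (hk : 0 < k) :
    g k q i = (2 * (k : ℚ) - 1) / 2 - i - q * (k - 1) / 2
      + 2 * ((∑ j ∈ Finset.range k, (i + q * (j : ℤ)) / (2 * (k : ℤ)) : ℤ) : ℚ) := by
  have hk' : (k : ℚ) ≠ 0 := by positivity
  have L : ∀ N : ℕ, ∑ j ∈ Finset.range N, ((i : ℚ) + q * j) = N * i + q * (N * (N - 1) / 2) := by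
    intro N
    induction N with
    | zero => simp
    | succ N ih => rw [Finset.sum_range_succ, ih]; push_cast; ring
  unfold g
  simp only [Int.emod_def, Int.toNat_natCast]
  push_cast
  rw [Finset.sum_sub_distrib, L, ← Finset.mul_sum]
  field_simp
  ring

lemma g_pos (k n : ℕ) (i : ℤ) (hk : 0 < k) (hi1 : -(k : ℤ) ≤ i)
    (hi2 : i < k + (2 * n + 1)) :
    g (k + (2 * n + 1)) (2 * n + 1) i = g k (2 * n + 1) i + 1 / 2 := by
  have h := g_eq (k + (2 * n + 1)) (2 * n + 1) i (by omega)
  have s := sum_floor k n i hk hi1 hi2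
  simp only [Nat.cast_add, Nat.cast_mul, Nat.cast_ofNat, Nat.cast_one] at h
  rw [h, g_eq k _ i hk, s]
  push_cast
  ring

lemma g_neg (k q i : ℤ) (hk : 0 < k) : g k (-q) (-1 - i) = - g k q i := by
  obtain ⟨K, rfl⟩ := Int.eq_ofNat_of_zero_le hk.le
  have hk' : (K : ℚ) ≠ 0 := by
    have : K ≠ 0 := by omega
    exact_mod_cast this
  have e : ∀ j : ℕ, (-1 - i + -q * (j : ℤ)) % (2 * (K : ℤ)) =
      2 * K - 1 - (i + q * j) % (2 * (K : ℤ)) := by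
    intro j
    have h1 := Int.emod_nonneg (i + q * j) (by omega : 2 * (K : ℤ) ≠ 0)
    have h2 := Int.emod_lt_of_pos (i + q * j) (by omega : 0 < 2 * (K : ℤ))
    have h3 := Int.emod_add_mul_ediv (i + q * j) (2 * (K : ℤ))
    generalize (i + q * j) % (2 * (K : ℤ)) = r at *
    generalize (i + q * j) / (2 * (K : ℤ)) = t at *
    have : (-1 - i + -q * (j : ℤ)) = (2 * K - 1 - r) + 2 * K * (-t - 1) := by linarith
    rw [this, Int.add_mul_emod_self_left, Int.emod_eq_of_lt] <;> omega
  unfold g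
  simp only [e, Int.toNat_natCast]
  push_cast
  rw [Finset.sum_sub_distrib]
  simp
  field_simp
  ring

theorem g_rec (k q i : ℤ) (hk : 0 < k) (hcop : IsCoprime q (2 * k))
    (hkq : 0 < k + q) (hi1 : -k ≤ i) (hi2 : i < k + q) :
    g (k + q) q i = g k q i + 1 / 2 := by
  have hodd : q % 2 = 1 := by
    have h2 : IsCoprime q 2 := hcop.of_mul_right_left
    obtain ⟨a, b, h⟩ := h2
    rcases Int.emod_two_eq_zero_or_one q with h0 | h0
    · obtain ⟨c, rfl⟩ := Int.dvd_of_emod_eq_zero h0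
      have : 2 * (a * c + b) = 1 := by linarith
      omega
    · exact h0
  rcases le_or_gt 0 q with hq | hq
  · obtain ⟨K, rfl⟩ := Int.eq_ofNat_of_zero_le hk.le
    obtain ⟨n, rfl⟩ : ∃ n : ℕ, q = 2 * n + 1 := ⟨(q / 2).toNat, by omega⟩
    exact g_pos K n i (by omega) hi1 hi2
  · obtain ⟨K, hK⟩ := Int.eq_ofNat_of_zero_le hkq.le
    obtain ⟨n, hn⟩ : ∃ n : ℕ, -q = 2 * n + 1 := ⟨((-q) / 2).toNat, by omega⟩
    have h := g_pos K n (-1 - i) (by omega) (by omega) (by omega)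
    rw [← hn, ← hK, show k + q + -q = k by ring, g_neg k q i hk, g_neg (k + q) q i hkq] at h
    linarith
end

section
/- Let k be a positive integer and let q be an integer coprime to 2k. Then for every integer i, g(2k, q, i) − g(2k, q, i + q) = (−1)^{⌊i/k⌋}; equivalently, this difference equals 1 if the least nonnegative residue [i] of i modulo 2k satisfies 0 ≤ [i] < k, and equals −1 if k ≤ [i] < 2k. -/
theorem g_sum_shift (k q i : ℤ) (n : ℕ) :
    ∑ j ∈ Finset.range n, (((i + q + q * (j : ℤ)) % (2 * k) : ℤ) : ℚ) -
      ∑ j ∈ Finset.range n, (((i + q * (j : ℤ)) % (2 * k) : ℤ) : ℚ) =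
      (((i + q * (n : ℤ)) % (2 * k) : ℤ) : ℚ) - ((i % (2 * k) : ℤ) : ℚ) := by
  rw [← Finset.sum_sub_distrib]
  have h := Finset.sum_range_sub (fun j : ℕ => (((i + q * (j : ℤ)) % (2 * k) : ℤ) : ℚ)) n
  simp only [Nat.cast_zero, mul_zero, add_zero] at h
  rw [← h]
  refine Finset.sum_congr rfl fun j _ => ?_
  have : i + q + q * (j : ℤ) = i + q * ((j + 1 : ℕ) : ℤ) := by push_cast; ring
  rw [this]

theorem g_diff_ite (k q : ℤ) (hk : 0 < k) (hcop : IsCoprime q (2 * k)) (i : ℤ) :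
    g k q i - g k q (i + q) = (if i % (2 * k) < k then 1 else -1) := by
  have hkQ : (k : ℚ) ≠ 0 := by exact_mod_cast hk.ne'
  have h := g_sum_shift k q i k.toNat
  rw [Int.toNat_of_nonneg hk.le] at h
  have hodd : ∃ m, q = 2 * m + 1 := by
    obtain ⟨a, b, hab⟩ := hcop
    rcases Int.even_or_odd' q with ⟨m, hm | hm⟩
    · exfalso
      have : 2 * (a * m + b * k) = 1 := by rw [← hab, hm]; ring
      omega
    · exact ⟨m, hm⟩
  obtain ⟨m, hm⟩ := hodd
  have e : (i + q * k) % (2 * k) = (i + k) % (2 * k) := by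
    have : i + q * k = i + k + (2 * k) * m := by rw [hm]; ring
    rw [this, Int.add_mul_emod_self_left]
  have hg : g k q i - g k q (i + q) =
      1 / (k : ℚ) * ((((i + q * k) % (2 * k) : ℤ) : ℚ) - ((i % (2 * k) : ℤ) : ℚ)) := by
    rw [← h]; unfold g; ring
  rw [hg, e]
  have h0 := Int.emod_nonneg i (show 2 * k ≠ 0 by omega)
  have h1 := Int.emod_lt_of_pos i (show 0 < 2 * k by omega)
  have e2 : (i + k) % (2 * k) = (i % (2 * k) + k) % (2 * k) := by
    rw [Int.emod_add_emod]
  split_ifs with hlt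
  · rw [e2, Int.emod_eq_of_lt (by omega) (by omega)]
    push_cast; field_simp; ring
  · have : (i % (2 * k) + k) % (2 * k) = i % (2 * k) - k := by
      rw [← Int.sub_emod_right, Int.emod_eq_of_lt (by omega) (by omega)]; ring
    rw [e2, this]
    push_cast; field_simp; ring

theorem g_sign (k : ℤ) (hk : 0 < k) (i : ℤ) :
    (-1 : ℚ) ^ (Int.fdiv i k) = (if i % (2 * k) < k then 1 else -1) := by
  rw [Int.fdiv_eq_ediv_of_nonneg _ hk.le]
  have h0 := Int.emod_nonneg i (show 2 * k ≠ 0 by omega)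
  have h1 := Int.emod_lt_of_pos i (show 0 < 2 * k by omega)
  have h2 := Int.emod_add_mul_ediv i (2 * k)
  have hd : i / k = 2 * (i / (2 * k)) + (i % (2 * k)) / k := by
    conv_lhs => rw [← h2]
    rw [show i % (2 * k) + 2 * k * (i / (2 * k)) = i % (2 * k) + k * (2 * (i / (2 * k))) by ring,
      Int.add_mul_ediv_left _ _ hk.ne']
    ring
  rw [hd]
  split_ifs with hlt
  · rw [Int.ediv_eq_zero_of_lt h0 hlt, add_zero]
    exact Even.neg_one_zpow (even_two_mul _)
  · have : (i % (2 * k)) / k = 1 := by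
      rw [Int.ediv_eq_iff_of_pos hk]; constructor <;> linarith
    rw [this]
    exact Odd.neg_one_zpow (odd_two_mul_add_one _)

theorem g_diff (k q : ℤ) (hk : 0 < k) (hcop : IsCoprime q (2 * k)) :
    ∀ i : ℤ, g k q i - g k q (i + q) = (-1 : ℚ) ^ (Int.fdiv i k) ∧
      g k q i - g k q (i + q) = (if i % (2 * k) < k then 1 else -1) := by
  intro i
  have h := g_diff_ite k q hk hcop i
  exact ⟨h.trans (g_sign k hk i).symm, h⟩
end

section
/- Let k be a positive integer, let i be an integer with 0 ≤ i < k, and let x be a complex number with x^k ≠ −1. Then the sum over the k complex numbers ζ satisfying ζ^k = −1 of ζ^{i+1}/(ζ − x) equals k·x^i/(1 + x^k). -/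
theorem sum_over_kth_roots_of_neg_one (k : ℕ) (hk : 0 < k) (i : ℤ) (hi0 : 0 ≤ i)
    (hik : i < (k : ℤ)) (x : ℂ) (hx : x ^ k ≠ -1) :
    ∑ᶠ ζ ∈ {ζ : ℂ | ζ ^ k = -1}, ζ ^ (i + 1) / (ζ - x) = (k : ℂ) * x ^ i / (1 + x ^ k) := by
  lift i to ℕ using hi0
  have hik' : i < k := by exact_mod_cast hik
  have hx1 : 1 + x ^ k ≠ 0 := fun h => hx (by linear_combination h)
  obtain ⟨α, hα⟩ := IsAlgClosed.exists_pow_nat_eq (-1 : ℂ) hk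
  have hα0 : α ≠ 0 := by
    rintro rfl
    rw [zero_pow hk.ne'] at hα
    norm_num at hα
  have hω := Complex.isPrimitiveRoot_exp k hk.ne'
  generalize Complex.exp (2 * Real.pi * Complex.I / k) = ω at hω
  have hset : {ζ : ℂ | ζ ^ k = -1}
      = ((Finset.range k).image (fun j => α * ω ^ j) : Finset ℂ) := by
    ext ζ
    simp only [Set.mem_setOf_eq, Finset.coe_image, Set.mem_image, Finset.coe_range, Set.mem_Iio]
    constructor
    · intro h
      have h1 : (ζ / α) ^ k = 1 := by rw [div_pow, h, hα]; norm_num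
      haveI : NeZero k := ⟨hk.ne'⟩
      obtain ⟨j, hj, hj'⟩ := hω.eq_pow_of_pow_eq_one h1
      refine ⟨j, hj, ?_⟩
      rw [hj']
      field_simp
    · rintro ⟨j, -, rfl⟩
      rw [mul_pow, hα, ← pow_mul, mul_comm j, pow_mul, hω.pow_eq_one]
      simp
  have hpow : ∀ n : ℕ, ∑ j ∈ Finset.range k, (α * ω ^ j) ^ n
      = if k ∣ n then k * α ^ n else 0 := by
    intro n
    have h1 : ∀ j, (α * ω ^ j) ^ n = α ^ n * (ω ^ n) ^ j := by
      intro j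
      rw [mul_pow, ← pow_mul, ← pow_mul, mul_comm j]
    simp only [h1, ← Finset.mul_sum]
    split_ifs with hd
    · rw [(hω.pow_eq_one_iff_dvd n).2 hd]
      simp [mul_comm]
    · have hne : ω ^ n ≠ 1 := fun h => hd ((hω.pow_eq_one_iff_dvd n).1 h)
      rw [geom_sum_eq hne, ← pow_mul, mul_comm n, pow_mul, hω.pow_eq_one]
      simp
  rw [hset, finsum_mem_coe_finset, Finset.sum_image]
  swap
  · intro a ha b hb hab
    exact hω.pow_inj (by simpa using ha) (by simpa using hb) (mul_left_cancel₀ hα0 hab)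
  have hterm : ∀ j ∈ Finset.range k, (α * ω ^ j) ^ ((i : ℤ) + 1) / (α * ω ^ j - x)
      = -(∑ m ∈ Finset.range k, x ^ (k - 1 - m) * (α * ω ^ j) ^ (m + i + 1)) / (1 + x ^ k) := by
    intro j _
    have hz : (α * ω ^ j) ^ k = -1 := by
      rw [mul_pow, hα, ← pow_mul, mul_comm j, pow_mul, hω.pow_eq_one]
      simp
    generalize α * ω ^ j = z at hz
    have hzx : z - x ≠ 0 := by
      intro h
      rw [sub_eq_zero.1 h] at hz
      exact hx hz
    have hg := (Commute.all z x).geom_sum₂_mul k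
    have hs : ∑ m ∈ Finset.range k, x ^ (k - 1 - m) * z ^ (m + i + 1)
        = (∑ m ∈ Finset.range k, z ^ m * x ^ (k - 1 - m)) * z ^ (i + 1) := by
      rw [Finset.sum_mul]
      refine Finset.sum_congr rfl fun m _ => ?_
      ring
    rw [hs, div_eq_div_iff hzx hx1]
    have : z ^ ((i : ℤ) + 1) = z ^ (i + 1) := by exact_mod_cast zpow_natCast z (i + 1)
    rw [this]
    rw [hz] at hg
    linear_combination (z ^ (i + 1)) * hg
  rw [Finset.sum_congr rfl hterm, ← Finset.sum_div, Finset.sum_neg_distrib, Finset.sum_comm]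
  simp only [← Finset.mul_sum, hpow]
  rw [Finset.sum_eq_single (k - 1 - i)]
  · have e1 : k - 1 - i + i + 1 = k := by omega
    have e2 : k - 1 - (k - 1 - i) = i := by omega
    rw [e1, e2, if_pos dvd_rfl, hα, zpow_natCast]
    congr 1
    ring
  · intro m hm hne
    rw [if_neg, mul_zero]
    rintro ⟨c, hc⟩
    have hm' := Finset.mem_range.1 hm
    have c1 : c = 1 := by
      have : 0 < c := by
        rcases Nat.eq_zero_or_pos c with rfl | h
        · omega
        · exact h
      have : c < 2 := by
        by_contra h
        have : k * 2 ≤ k * c := Nat.mul_le_mul_left k (by omega)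
        omega
      omega
    subst c1
    omega
  · intro h
    exact absurd (Finset.mem_range.2 (by omega)) h
end

section
/- Let k be a positive integer, let i be an integer with 0 ≤ i < 2k, and let x be a complex number with x^{2k} ≠ 1. Then the sum over the 2k complex 2k-th roots of unity ζ of ζ^{i+1}/(ζ − x) equals 2k·x^i/(1 − x^{2k}). -/
theorem aux_powsum (n : ℕ) (w : ℂ) (hw : IsPrimitiveRoot w n) (s : ℕ) :
    ∑ m ∈ Finset.range n, (w ^ m) ^ s = if n ∣ s then (n : ℂ) else 0 := by
  have h1 : ∀ m ∈ Finset.range n, (w ^ m) ^ s = (w ^ s) ^ m := fun m _ => by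
    rw [← pow_mul, ← pow_mul, mul_comm]
  rw [Finset.sum_congr rfl h1]
  split_ifs with h
  · rw [(hw.pow_eq_one_iff_dvd s).2 h]; simp
  · have h2 : w ^ s ≠ 1 := fun h' => h ((hw.pow_eq_one_iff_dvd s).1 h')
    rw [geom_sum_eq h2, ← pow_mul, mul_comm, pow_mul, hw.pow_eq_one]; simp

theorem aux_main (n : ℕ) (hn : 0 < n) (i : ℕ) (hi : i < n) (x : ℂ) (hx : x ^ n ≠ 1) :
    ∑ᶠ ζ ∈ {ζ : ℂ | ζ ^ n = 1}, ζ ^ (i + 1) / (ζ - x) = n * x ^ i / (1 - x ^ n) := by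
  classical
  have hw := Complex.isPrimitiveRoot_exp n hn.ne'
  set w := Complex.exp (2 * Real.pi * Complex.I / n) with hwdef
  clear_value w
  have : NeZero n := ⟨hn.ne'⟩
  have hset : {ζ : ℂ | ζ ^ n = 1} = (((Finset.range n).image (fun m => w ^ m) : Finset ℂ) : Set ℂ) := by
    ext ζ
    simp only [Set.mem_setOf_eq, Finset.coe_image, Finset.coe_range, Set.mem_image, Set.mem_Iio]
    constructor
    · intro h
      exact hw.eq_pow_of_pow_eq_one h
    · rintro ⟨m, -, rfl⟩
      rw [← pow_mul, mul_comm, pow_mul, hw.pow_eq_one, one_pow]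
  rw [hset, finsum_mem_coe_finset, Finset.sum_image (by
    intro a ha b hb hab
    exact hw.pow_inj (by simpa using ha) (by simpa using hb) hab)]
  have hx' : 1 - x ^ n ≠ 0 := sub_ne_zero.2 (Ne.symm hx)
  have key : ∀ m ∈ Finset.range n, (w ^ m) ^ (i + 1) / (w ^ m - x) =
      (∑ j ∈ Finset.range n, (w ^ m) ^ (i + 1 + j) * x ^ (n - 1 - j)) / (1 - x ^ n) := by
    intro m _
    have hz : (w ^ m) ^ n = 1 := by
      rw [← pow_mul, mul_comm, pow_mul, hw.pow_eq_one, one_pow]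
    generalize w ^ m = z at hz
    have hzx : z - x ≠ 0 := by
      intro h
      rw [sub_eq_zero] at h
      exact hx (h ▸ hz)
    have hg := (Commute.all z x).geom_sum₂_mul n
    rw [hz] at hg
    rw [div_eq_div_iff hzx hx', ← hg]
    simp only [pow_add, mul_assoc, ← Finset.mul_sum]
  rw [Finset.sum_congr rfl key, ← Finset.sum_div, Finset.sum_comm]
  congr 1
  simp only [← Finset.sum_mul, aux_powsum n w hw]
  rw [Finset.sum_eq_single (n - 1 - i)]
  · rw [if_pos (by rw [show i + 1 + (n - 1 - i) = n by omega])]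
    rw [show n - 1 - (n - 1 - i) = i by omega]
  · intro j hj hne
    rw [if_neg, zero_mul]
    rintro ⟨c, hc⟩
    have hj' := Finset.mem_range.1 hj
    have : c = 1 := by
      have h1 : c < 2 := by
        by_contra h
        have := Nat.mul_le_mul_left n (not_lt.1 h)
        omega
      have h0 : c ≠ 0 := by
        rintro rfl
        simp at hc
      omega
    subst this
    omega
  · intro h
    exact absurd (Finset.mem_range.2 (by omega)) h

theorem sum_over_2kth_roots_of_unity (k : ℕ) (hk : 0 < k) (i : ℤ) (hi0 : 0 ≤ i)
    (hik : i < 2 * (k : ℤ)) (x : ℂ) (hx : x ^ (2 * k) ≠ 1) :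
    ∑ᶠ ζ ∈ {ζ : ℂ | ζ ^ (2 * k) = 1}, ζ ^ (i + 1) / (ζ - x) =
      2 * (k : ℂ) * x ^ i / (1 - x ^ (2 * k)) := by
  lift i to ℕ using hi0
  have h := aux_main (2 * k) (by omega) i (by omega) x hx
  push_cast at h
  rw [zpow_natCast, ← h]
  have h2 : ∀ ζ : ℂ, ζ ^ ((i : ℤ) + 1) = ζ ^ (i + 1) := fun ζ => by
    rw [← zpow_natCast]; push_cast; rfl
  simp only [h2]
end

section
/- Let k be a positive integer, let q be an integer coprime to 2k, and let i be any integer. Then, as an identity of complex numbers, g(2k, q, i) = −(2/k) · Σ_{ζ^k = −1} ζ^{i+1}/((ζ − 1)(ζ^q − 1)), where the sum runs over the k complex numbers ζ with ζ^k = −1, and ζ^{i+1}, ζ^q denote integer powers of the nonzero complex number ζ. -/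
theorem anti_zero (D : ℤ → ℂ) (q k : ℤ) (hq : Odd q) (h1 : ∀ i, D (i + q) = D i)
    (h2 : ∀ i, D (i + k) = - D i) (i : ℤ) : D i = 0 := by
  have e1 : ∀ (n : ℤ) i, D (i + n * q) = D i := by
    intro n
    induction n using Int.induction_on with
    | zero => simp
    | succ n ih => intro i; rw [← ih i, ← h1 (i + n * q)]; congr 1; ring
    | pred n ih => intro i; rw [← ih i, ← h1 (i + (-n - 1) * q)]; congr 1; ring
  have e2 : ∀ (n : ℤ) i, D (i + n * (2 * k)) = D i := by
    have h3 : ∀ i, D (i + 2 * k) = D i := by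
      intro i
      rw [two_mul, ← add_assoc, h2, h2, neg_neg]
    intro n
    induction n using Int.induction_on with
    | zero => simp
    | succ n ih => intro i; rw [← ih i, ← h3 (i + n * (2 * k))]; congr 1; ring
    | pred n ih => intro i; rw [← ih i, ← h3 (i + (-n - 1) * (2 * k))]; congr 1; ring
  obtain ⟨m, hm⟩ := hq
  have a := e1 k i
  have b : D (i + k * q) = - D i := by
    rw [← h2 i, ← e2 m (i + k)]; congr 1; rw [hm]; ring
  have c : D i = - D i := a.symm.trans b
  linear_combination (1/2) * c

theorem exists_roots (K : ℕ) (hK : 0 < K) : ∃ s : Finset ℂ, (∀ z, z ∈ s ↔ z ^ K = -1) ∧ s.card = K := by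
  have hp := Complex.isPrimitiveRoot_exp K hK.ne'
  have hc := hp.card_nthRoots (-1 : ℂ)
  have : ∃ α : ℂ, α ^ K = -1 := IsAlgClosed.exists_pow_nat_eq _ hK
  rw [if_pos this] at hc
  refine ⟨⟨Polynomial.nthRoots K (-1 : ℂ), hp.nthRoots_nodup (by norm_num)⟩, ?_, hc⟩
  intro z
  simp [Polynomial.mem_nthRoots hK]

theorem sum_pow_zero (K : ℕ) (hK : 0 < K) (s : Finset ℂ) (hs : ∀ z, z ∈ s ↔ z ^ K = -1) (i : ℤ)
    (hi : ¬ (K : ℤ) ∣ i) : ∑ z ∈ s, z ^ i = 0 := by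
  have hp := Complex.isPrimitiveRoot_exp K hK.ne'
  set w := Complex.exp (2 * Real.pi * Complex.I / K)
  have hw0 : w ≠ 0 := Complex.exp_ne_zero _
  have hw : w ^ i ≠ 1 := fun h => hi ((hp.zpow_eq_one_iff_dvd i).1 h)
  have : ∑ z ∈ s, z ^ i = ∑ z ∈ s, (w * z) ^ i := by
    symm
    refine Finset.sum_bij' (fun z _ => w * z) (fun z _ => w⁻¹ * z) ?_ ?_ ?_ ?_ ?_
    · intro z hz; rw [hs] at *; rw [mul_pow, hp.pow_eq_one, hz, one_mul]
    · intro z hz; rw [hs] at *; rw [mul_pow, inv_pow, hp.pow_eq_one, hz, inv_one, one_mul]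
    · intro z hz; field_simp
    · intro z hz; field_simp
    · intro z hz; rfl
  simp_rw [mul_zpow, ← Finset.mul_sum] at this
  have h2 : (w ^ i - 1) * ∑ z ∈ s, z ^ i = 0 := by linear_combination -this
  exact (mul_eq_zero.1 h2).resolve_left (sub_ne_zero.2 hw)

theorem pow_shift {K : ℕ} {z : ℂ} (hK : 0 < K) (hz : z ^ K = -1) (i : ℤ) : z ^ (i + K) = - z ^ i := by
  have : z ≠ 0 := by rintro rfl; simp [hK.ne'] at hz
  rw [zpow_add₀ this, zpow_natCast, hz]; ring

/-- square wave -/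
noncomputable def sqw (K : ℕ) (i : ℤ) : ℂ := if i % (2 * K) < K then 1 else -1

theorem mod_shift (K : ℕ) (hK : 0 < K) (i : ℤ) :
    (i + K) % (2 * K) = if i % (2 * K) < K then i % (2 * K) + K else i % (2 * K) - K := by
  have h0 := Int.emod_nonneg i (b := 2 * K) (by omega)
  have h1 := Int.emod_lt_of_pos i (b := 2 * K) (by omega)
  split_ifs with h
  · rw [Int.add_emod, Int.emod_eq_of_lt (a := (K : ℤ)) (by omega) (by omega)]
    exact Int.emod_eq_of_lt (by omega) (by omega)
  · rw [Int.add_emod, Int.emod_eq_of_lt (a := (K : ℤ)) (by omega) (by omega)]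
    rw [← Int.sub_emod_right]
    rw [Int.emod_eq_of_lt (by omega) (by omega)]; ring

theorem sqw_shift (K : ℕ) (hK : 0 < K) (i : ℤ) : sqw K (i + K) = - sqw K i := by
  unfold sqw
  rw [mod_shift K hK]
  have h0 := Int.emod_nonneg i (b := 2 * K) (by omega)
  have h1 := Int.emod_lt_of_pos i (b := 2 * K) (by omega)
  by_cases h : i % (2 * K) < K
  · simp only [h, if_true]; rw [if_neg (by omega)]
  · simp only [h, if_false]; rw [if_pos (by omega)]; simp

theorem S_eq (K : ℕ) (hK : 0 < K) (s : Finset ℂ) (hs : ∀ z, z ∈ s ↔ z ^ K = -1) (hc : s.card = K)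
    (i : ℤ) : ∑ z ∈ s, z ^ (i + 1) / (z - 1) = K / 2 * sqw K i := by
  rw [← sub_eq_zero]
  refine anti_zero (fun i => ∑ z ∈ s, z ^ (i + 1) / (z - 1) - K / 2 * sqw K i) 1 K odd_one ?_ ?_ i
  · intro i
    have key : ∑ z ∈ s, z ^ (i + 1 + 1) / (z - 1) - ∑ z ∈ s, z ^ (i + 1) / (z - 1)
        = ∑ z ∈ s, z ^ (i + 1) := by
      rw [← Finset.sum_sub_distrib]
      refine Finset.sum_congr rfl fun z hz => ?_
      rw [hs] at hz
      have h0 : z ≠ 0 := by rintro rfl; simp [hK.ne'] at hz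
      have h1 : z - 1 ≠ 0 := by
        intro h; rw [sub_eq_zero.1 h, one_pow] at hz; norm_num at hz
      rw [zpow_add_one₀ h0 (i + 1)]
      field_simp
    have key2 : ∑ z ∈ s, z ^ (i + 1) = K / 2 * sqw K (i + 1) - K / 2 * sqw K i := by
      by_cases hd : (K : ℤ) ∣ i + 1
      · obtain ⟨m, hm⟩ := hd
        have hpow : ∀ z ∈ s, z ^ (i + 1) = (-1) ^ m := by
          intro z hz
          rw [hs] at hz
          rw [hm, zpow_mul, zpow_natCast, hz]
        rw [Finset.sum_congr rfl hpow, Finset.sum_const, hc, nsmul_eq_mul]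
        obtain ⟨n, hn | hn⟩ := Int.even_or_odd' m
        · have e1 : (i + 1) % (2 * K) = 0 := by
            rw [hm, hn]; apply Int.emod_eq_zero_of_dvd; exact ⟨n, by ring⟩
          have e2 : i % (2 * K) = 2 * K - 1 := by
            have : i = (2 * K - 1) + (2 * K) * (n - 1) := by rw [hn] at hm; linear_combination hm
            rw [this, Int.add_mul_emod_self_left]; exact Int.emod_eq_of_lt (by omega) (by omega)
          unfold sqw
          rw [e1, e2, if_pos (by omega), if_neg (by omega), hn, zpow_mul]
          norm_num
        · have e1 : (i + 1) % (2 * K) = K := by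
            have : i + 1 = K + (2 * K) * n := by rw [hn] at hm; linear_combination hm
            rw [this, Int.add_mul_emod_self_left]; exact Int.emod_eq_of_lt (by omega) (by omega)
          have e2 : i % (2 * K) = K - 1 := by
            have : i = (K - 1) + (2 * K) * n := by rw [hn] at hm; linear_combination hm
            rw [this, Int.add_mul_emod_self_left]; exact Int.emod_eq_of_lt (by omega) (by omega)
          unfold sqw
          rw [e1, e2, if_neg (by omega), if_pos (by omega), hn, zpow_add₀ (by norm_num), zpow_mul]
          norm_num
          ring
      · rw [sum_pow_zero K hK s hs _ hd]
        have : sqw K (i + 1) = sqw K i := by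
          have h0 := Int.emod_nonneg i (b := 2 * K) (by omega)
          have h1 := Int.emod_lt_of_pos i (b := 2 * K) (by omega)
          have h2 := Int.emod_add_mul_ediv i (2 * K)
          have n1 : i % (2 * K) ≠ 2 * K - 1 := by
            intro h; apply hd; exact ⟨2 * (i / (2 * K)) + 2, by rw [h] at h2; linear_combination -h2⟩
          have n2 : i % (2 * K) ≠ K - 1 := by
            intro h; apply hd; exact ⟨2 * (i / (2 * K)) + 1, by rw [h] at h2; linear_combination -h2⟩
          have e : (i + 1) % (2 * K) = i % (2 * K) + 1 := by
            conv_lhs => rw [← h2, add_right_comm, Int.add_mul_emod_self_left]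
            exact Int.emod_eq_of_lt (by omega) (by omega)
          unfold sqw
          rw [e]
          by_cases h : i % (2 * K) < K
          · rw [if_pos h, if_pos (by omega)]
          · rw [if_neg h, if_neg (by omega)]
        rw [this]; ring
    linear_combination key + key2
  · intro i
    rw [sqw_shift K hK]
    have : ∑ z ∈ s, z ^ (i + K + 1) / (z - 1) = - ∑ z ∈ s, z ^ (i + 1) / (z - 1) := by
      rw [← Finset.sum_neg_distrib]
      refine Finset.sum_congr rfl fun z hz => ?_
      rw [add_right_comm, pow_shift hK ((hs z).1 hz), neg_div]
    rw [this]; ring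

theorem full_sum (K : ℕ) (hK : 0 < K) (q i : ℤ) (hcop : IsCoprime q (2 * (K : ℤ))) :
    ∑ j ∈ Finset.range (2 * K), (i + q * (j : ℤ)) % (2 * K) = K * (2 * K - 1) := by
  have hlt : ∀ m : ℤ, 0 ≤ m % (2 * K) ∧ m % (2 * K) < 2 * K := fun m =>
    ⟨Int.emod_nonneg m (by omega), Int.emod_lt_of_pos m (by omega)⟩
  let f : ℕ → ℕ := fun j => ((i + q * (j : ℤ)) % (2 * K)).toNat
  have hf : ∀ j : ℕ, (f j : ℤ) = (i + q * (j : ℤ)) % (2 * K) := fun j =>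
    Int.toNat_of_nonneg (hlt _).1
  have hinj : Set.InjOn f (Finset.range (2 * K) : Finset ℕ) := by
    intro a ha b hb hab
    simp only [Finset.coe_range, Set.mem_Iio] at ha hb
    have h : (i + q * (a : ℤ)) % (2 * K) = (i + q * (b : ℤ)) % (2 * K) := by
      rw [← hf, ← hf, hab]
    have h2 := Int.emod_emod_of_dvd
    have h3 : (2 * K : ℤ) ∣ q * (b - a) := by
      have := Int.ModEq.dvd (n := 2 * K) h
      have e : (i + q * (b : ℤ)) - (i + q * a) = q * (b - a) := by ring
      rwa [e] at this
    have h4 := hcop.symm.dvd_of_dvd_mul_left h3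
    have := Int.eq_zero_of_abs_lt_dvd h4 (by rw [abs_lt]; constructor <;> omega)
    omega
  have himg : (Finset.range (2 * K)).image f = Finset.range (2 * K) := by
    apply Finset.eq_of_subset_of_card_le
    · intro x hx
      obtain ⟨j, -, rfl⟩ := Finset.mem_image.1 hx
      rw [Finset.mem_range]
      have := (hlt (i + q * j)).2
      rw [← hf] at this
      omega
    · rw [Finset.card_image_of_injOn hinj]
  have h5 : ∑ x ∈ Finset.range (2 * K), (x : ℤ) = ∑ j ∈ Finset.range (2 * K), (f j : ℤ) := by
    conv_lhs => rw [← himg]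
    exact Finset.sum_image hinj
  simp_rw [← hf]
  rw [← h5]
  have h6 := Finset.sum_range_id_mul_two (2 * K)
  have h7 : (∑ x ∈ Finset.range (2 * K), (x : ℤ)) * 2 = 2 * K * (2 * K - 1) := by
    have := congrArg (Nat.cast : ℕ → ℤ) h6
    push_cast [Nat.cast_sub (show 1 ≤ 2 * K by omega)] at this
    exact this
  linarith

theorem g_as_dedekind_like_sum (k q i : ℤ) (hk : 0 < k) (hcop : IsCoprime q (2 * k)) :
    ((g k q i : ℚ) : ℂ) =
      -(2 / (k : ℂ)) * ∑ᶠ ζ ∈ {ζ : ℂ | ζ ^ k = -1}, ζ ^ (i + 1) / ((ζ - 1) * (ζ ^ q - 1)) := by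
  lift k to ℕ using hk.le with K
  have hK : 0 < K := by exact_mod_cast hk
  have hKC : (K : ℂ) ≠ 0 := by exact_mod_cast hK.ne'
  obtain ⟨s, hs, hc⟩ := exists_roots K hK
  have hset : {ζ : ℂ | ζ ^ (K : ℤ) = -1} = (s : Set ℂ) := by
    ext z; simp [hs]
  rw [hset, finsum_mem_coe_finset]
  have hq : Odd q := by
    rw [← Int.not_even_iff_odd]
    intro h
    have h2 : (2 : ℤ) ∣ q := h.two_dvd
    have := hcop.isUnit_of_dvd' h2 (dvd_mul_right _ _)
    rw [Int.isUnit_iff] at this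
    omega
  have hqm : ∃ m, q = 2 * m + 1 := hq
  have hg : ∀ i, ((g K q i : ℚ) : ℂ) = (2 * K - 1) / 2 -
      1 / K * ∑ j ∈ Finset.range K, (((i + q * (j : ℤ)) % (2 * K) : ℤ) : ℂ) := by
    intro i; unfold g; push_cast; simp
  have hqK : ∀ i : ℤ, (i + q * K) % (2 * K) = (i + K) % (2 * K) := by
    intro i
    obtain ⟨m, hm⟩ := hqm
    rw [show i + q * K = i + K + (2 * K) * m by rw [hm]; ring, Int.add_mul_emod_self_left]
  rw [← sub_eq_zero]
  refine anti_zero (fun i => ((g K q i : ℚ) : ℂ) -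
    -(2 / (K : ℂ)) * ∑ z ∈ s, z ^ (i + 1) / ((z - 1) * (z ^ q - 1))) q K hq ?_ ?_ i
  · intro i
    have key : ∑ z ∈ s, z ^ (i + q + 1) / ((z - 1) * (z ^ q - 1))
        - ∑ z ∈ s, z ^ (i + 1) / ((z - 1) * (z ^ q - 1)) = K / 2 * sqw K i := by
      rw [← S_eq K hK s hs hc, ← Finset.sum_sub_distrib]
      refine Finset.sum_congr rfl fun z hz => ?_
      rw [hs] at hz
      have h0 : z ≠ 0 := by rintro rfl; simp [hK.ne'] at hz
      have hz1 : z ≠ 1 := by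
        intro h; rw [h, one_pow] at hz; norm_num at hz
      have h1 : z - 1 ≠ 0 := sub_ne_zero.2 hz1
      have h2 : z ^ q - 1 ≠ 0 := by
        rw [sub_ne_zero]
        intro h
        obtain ⟨u, v, huv⟩ := hcop
        apply hz1
        have h3 : z ^ (2 * (K : ℤ)) = 1 := by
          rw [mul_comm, zpow_mul, zpow_natCast, hz]; norm_num
        rw [← zpow_one z, ← huv, zpow_add₀ h0, mul_comm u, mul_comm v, zpow_mul, zpow_mul, h, h3]
        simp
      rw [add_right_comm, zpow_add₀ h0 (i + 1) q]
      field_simp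
    have key2 : ((g K q (i + q) : ℚ) : ℂ) - ((g K q i : ℚ) : ℂ) = - sqw K i := by
      have e1 : ∑ j ∈ Finset.range K, (((i + q + q * (j : ℤ)) % (2 * K) : ℤ) : ℂ)
          - ∑ j ∈ Finset.range K, (((i + q * (j : ℤ)) % (2 * K) : ℤ) : ℂ) = K * sqw K i := by
        rw [← Finset.sum_sub_distrib]
        have := Finset.sum_range_sub (fun j : ℕ => (((i + q * (j : ℤ)) % (2 * K) : ℤ) : ℂ)) K
        have e : ∀ j : ℕ, i + q * ((j + 1 : ℕ) : ℤ) = i + q + q * j := by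
          intro j; push_cast; ring
        simp only [e] at this
        rw [this, hqK, mod_shift K hK]
        unfold sqw
        simp only [Nat.cast_zero, mul_zero, add_zero]
        split_ifs <;> push_cast <;> ring
      rw [hg, hg]
      have : (1 / K : ℂ) * (K * sqw K i) = sqw K i := by field_simp
      linear_combination (-1 / K : ℂ) * e1 - this
    have h3 : (2 / K : ℂ) * (K / 2 * sqw K i) = sqw K i := by field_simp
    linear_combination key2 + (2 / K : ℂ) * key + h3
  · intro i
    have key : ∑ z ∈ s, z ^ (i + K + 1) / ((z - 1) * (z ^ q - 1)) =
        - ∑ z ∈ s, z ^ (i + 1) / ((z - 1) * (z ^ q - 1)) := by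
      rw [← Finset.sum_neg_distrib]
      refine Finset.sum_congr rfl fun z hz => ?_
      rw [add_right_comm, pow_shift hK ((hs z).1 hz), neg_div]
    have key2 : ((g K q (i + K) : ℚ) : ℂ) = - ((g K q i : ℚ) : ℂ) := by
      have hfull := full_sum K hK q i hcop
      rw [two_mul K, Finset.sum_range_add] at hfull
      have e : ∀ j : ℕ, (i + q * ((K + j : ℕ) : ℤ)) % (2 * K) = (i + K + q * j) % (2 * K) := by
        intro j
        rw [show i + q * ((K + j : ℕ) : ℤ) = (i + q * j) + q * K by push_cast; ring, hqK]
        congr 1; ring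
      simp only [e] at hfull
      have h := congrArg (Int.cast : ℤ → ℂ) hfull
      simp only [Int.cast_add, Int.cast_sum, Int.cast_mul, Int.cast_sub, Int.cast_natCast,
        Int.cast_ofNat, Int.cast_one] at h
      rw [hg, hg]
      have h3 : (1 / K : ℂ) * (K * (2 * K - 1)) = 2 * K - 1 := by field_simp
      linear_combination (-1 / K : ℂ) * h - h3
    rw [key, key2]; ring
end

section
/- Let k be a positive integer and let i be any integer. Then the sum over the k complex numbers ζ satisfying ζ^k = −1 of ζ^{i+1}/(ζ − 1) equals (−1)^{⌊i/k⌋} · k/2, where ζ^{i+1} denotes the integer power of the nonzero complex number ζ. -/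
open Polynomial in
theorem aux_mem (n : ℕ) (hn : 0 < n) (z : ℂ) : z ∈ nthRootsFinset n (-1 : ℂ) ↔ z ^ n = -1 :=
  mem_nthRootsFinset hn _

open Polynomial in
theorem aux_card (n : ℕ) (hn : 0 < n) : (nthRootsFinset n (-1 : ℂ)).card = n := by
  have hp := Complex.isPrimitiveRoot_exp n hn.ne'
  have hc := hp.card_nthRoots (-1 : ℂ)
  rw [if_pos (IsAlgClosed.exists_pow_nat_eq (-1 : ℂ) hn)] at hc
  have hd := hp.nthRoots_nodup (a := (-1 : ℂ)) (by norm_num)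
  classical
  rw [nthRootsFinset_def, Multiset.toFinset_card_of_nodup hd, hc]

open Polynomial in
theorem aux_sum (n : ℕ) (j : ℕ) (h0 : 0 < j) (hj : j < n) :
    ∑ z ∈ nthRootsFinset n (-1 : ℂ), z ^ j = 0 := by
  have hn : 0 < n := h0.trans hj
  have hp := Complex.isPrimitiveRoot_exp n hn.ne'
  set w := Complex.exp (2 * Real.pi * Complex.I / n)
  have hw0 : w ≠ 0 := hp.ne_zero hn.ne'
  have hw : w ^ n = 1 := hp.pow_eq_one
  have hwj : w ^ j ≠ 1 := hp.pow_ne_one_of_pos_of_lt h0.ne' hj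
  have key : ∑ z ∈ nthRootsFinset n (-1 : ℂ), z ^ j
      = ∑ z ∈ nthRootsFinset n (-1 : ℂ), w ^ j * z ^ j := by
    symm
    refine Finset.sum_bij' (fun z _ => w * z) (fun z _ => w⁻¹ * z) ?_ ?_ ?_ ?_ ?_
    · intro z hz
      rw [aux_mem n hn] at hz ⊢
      rw [mul_pow, hw, hz, one_mul]
    · intro z hz
      rw [aux_mem n hn] at hz ⊢
      rw [mul_pow, inv_pow, hw, hz, inv_one, one_mul]
    · intro z _
      field_simp
    · intro z _
      field_simp
    · intro z _
      rw [mul_pow]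
  rw [← Finset.mul_sum] at key
  have : (1 - w ^ j) * ∑ z ∈ nthRootsFinset n (-1 : ℂ), z ^ j = 0 := by
    linear_combination key
  rcases mul_eq_zero.mp this with h | h
  · exact absurd (sub_eq_zero.mp h).symm hwj
  · exact h

open Polynomial in
theorem aux_main_s9 (n : ℕ) (hn : 0 < n) (j : ℕ) (hj : j < n) :
    ∑ z ∈ nthRootsFinset n (-1 : ℂ), z ^ (j + 1) / (z - 1) = n / 2 := by
  have hne : ∀ z ∈ nthRootsFinset n (-1 : ℂ), z - 1 ≠ 0 := by
    intro z hz h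
    rw [aux_mem n hn, sub_eq_zero.mp h] at hz
    norm_num at hz
  have step : ∀ m : ℕ, ∑ z ∈ nthRootsFinset n (-1 : ℂ), z ^ (m + 1) / (z - 1)
      = ∑ z ∈ nthRootsFinset n (-1 : ℂ), z ^ m / (z - 1)
        + ∑ z ∈ nthRootsFinset n (-1 : ℂ), z ^ m := by
    intro m
    rw [← Finset.sum_add_distrib]
    refine Finset.sum_congr rfl fun z hz => ?_
    have := hne z hz
    field_simp
    ring
  have const : ∀ m : ℕ, m < n → ∑ z ∈ nthRootsFinset n (-1 : ℂ), z ^ (m + 1) / (z - 1)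
      = ∑ z ∈ nthRootsFinset n (-1 : ℂ), z ^ (0 + 1) / (z - 1) := by
    intro m
    induction m with
    | zero => intro _; rfl
    | succ m ih =>
      intro h
      rw [step (m + 1), ih (by omega), aux_sum n (m + 1) (by omega) h, add_zero]
  have h1 := const (n - 1) (by omega)
  rw [Nat.sub_add_cancel hn] at h1
  have h2 : ∑ z ∈ nthRootsFinset n (-1 : ℂ), z ^ n / (z - 1)
      = - ∑ z ∈ nthRootsFinset n (-1 : ℂ), z ^ 0 / (z - 1) := by
    rw [← Finset.sum_neg_distrib]
    refine Finset.sum_congr rfl fun z hz => ?_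
    rw [(aux_mem n hn z).mp hz, pow_zero, neg_div]
  have h3 := step 0
  have h4 : ∑ z ∈ nthRootsFinset n (-1 : ℂ), z ^ 0 = (n : ℂ) := by
    simp [aux_card n hn]
  rw [const j hj]
  linear_combination (1 / 2 : ℂ) * h3 + (1 / 2 : ℂ) * h4 + (1 / 2 : ℂ) * h2 - (1 / 2 : ℂ) * h1

theorem sum_zeta_pow_div_zeta_sub_one (k : ℤ) (hk : 0 < k) (i : ℤ) :
    ∑ᶠ ζ ∈ {ζ : ℂ | ζ ^ k = -1}, ζ ^ (i + 1) / (ζ - 1) =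
      (-1 : ℂ) ^ (Int.fdiv i k) * (k : ℂ) / 2 := by
  lift k to ℕ using hk.le with n
  have hn : 0 < n := by exact_mod_cast hk
  have hset : {ζ : ℂ | ζ ^ (n : ℤ) = -1} = ↑(Polynomial.nthRootsFinset n (-1 : ℂ)) := by
    ext z
    rw [Finset.mem_coe, aux_mem n hn, Set.mem_setOf_eq, zpow_natCast]
  rw [hset, finsum_mem_coe_finset, Int.fdiv_eq_ediv_of_nonneg _ hk.le]
  obtain ⟨j, hj⟩ := Int.eq_ofNat_of_zero_le (Int.emod_nonneg i hk.ne')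
  have hjn : j < n := by
    have := Int.emod_lt_of_pos i hk
    omega
  have hi : i + 1 = (n : ℤ) * (i / n) + ((j + 1 : ℕ) : ℤ) := by
    have := Int.mul_ediv_add_emod i n
    push_cast
    linarith
  have hm := aux_main_s9 n hn j hjn
  rw [mul_div_assoc, Int.cast_natCast, ← hm, Finset.mul_sum]
  refine Finset.sum_congr rfl fun z hz => ?_
  rw [aux_mem n hn] at hz
  have hz0 : z ≠ 0 := by
    rintro rfl
    rw [zero_pow hn.ne'] at hz
    norm_num at hz
  generalize i / (n : ℤ) = q at hi ⊢
  rw [hi, zpow_add₀ hz0, zpow_mul, zpow_natCast, zpow_natCast, hz, mul_div_assoc]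
end

section
/- Let k be a positive integer, let q be an integer coprime to 2k, and let i be any integer. Then g(2k, q, i) = (1/2) · Σ_{j=0}^{k−1} (−1)^{⌊(i+qj)/k⌋}. -/
theorem g_aux_residues (k q i : ℤ) (hk : 0 < k) (hcop : IsCoprime q k) :
    ∑ j ∈ Finset.range k.toNat, (i + q * (j : ℤ)) % k
      = ∑ j ∈ Finset.range k.toNat, (j : ℤ) := by
  have hmaps : ∀ j ∈ Finset.range k.toNat,
      ((i + q * (j : ℤ)) % k).toNat ∈ Finset.range k.toNat := by
    intro j _
    have h1 := Int.emod_nonneg (i + q * (j : ℤ)) hk.ne'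
    have h2 := Int.emod_lt_of_pos (i + q * (j : ℤ)) hk
    rw [Finset.mem_range]; omega
  have hinj : Set.InjOn (fun j : ℕ => ((i + q * (j : ℤ)) % k).toNat)
      (Finset.range k.toNat : Set ℕ) := by
    intro a ha b hb hab
    simp only [Finset.coe_range, Set.mem_Iio] at ha hb hab
    have h1 := Int.emod_nonneg (i + q * (a : ℤ)) hk.ne'
    have h2 := Int.emod_nonneg (i + q * (b : ℤ)) hk.ne'
    have h3 : (i + q * (a : ℤ)) % k = (i + q * (b : ℤ)) % k := by omega
    have h4 : k ∣ q * ((a : ℤ) - b) := by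
      have h := Int.dvd_of_emod_eq_zero (Int.emod_eq_emod_iff_emod_sub_eq_zero.1 h3)
      rwa [show i + q * (a : ℤ) - (i + q * (b : ℤ)) = q * ((a : ℤ) - b) by ring] at h
    have h5 : k ∣ (a : ℤ) - b := hcop.symm.dvd_of_dvd_mul_left h4
    have h6 := Int.eq_zero_of_abs_lt_dvd h5 (by rw [abs_lt]; omega)
    omega
  have himg : (Finset.range k.toNat).image (fun j : ℕ => ((i + q * (j : ℤ)) % k).toNat)
      = Finset.range k.toNat := by
    apply Finset.eq_of_subset_of_card_le
    · intro x hx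
      obtain ⟨j, hj, rfl⟩ := Finset.mem_image.1 hx
      exact hmaps j hj
    · rw [Finset.card_image_of_injOn hinj]
  conv_rhs => rw [← himg]
  rw [Finset.sum_image hinj]
  apply Finset.sum_congr rfl
  intro j _
  have h1 := Int.emod_nonneg (i + q * (j : ℤ)) hk.ne'
  omega

theorem g_aux_term (k m : ℤ) (hk : 0 < k) :
    ((m % (2 * k) : ℤ) : ℚ) = ((m % k : ℤ) : ℚ)
      + (k : ℚ) * (1 - (-1 : ℚ) ^ (Int.fdiv m k)) / 2 := by
  rw [Int.fdiv_eq_ediv_of_nonneg _ hk.le]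
  have hm := Int.emod_add_mul_ediv m k
  have h1 := Int.emod_nonneg m hk.ne'
  have h2 := Int.emod_lt_of_pos m hk
  rcases Int.even_or_odd (m / k) with he | ho
  · rw [he.neg_one_zpow]
    obtain ⟨c, hc⟩ := he
    have : m % (2 * k) = m % k := by
      conv_lhs => rw [← hm, hc, show m % k + k * (c + c) = m % k + (2 * k) * c by ring,
        Int.add_mul_emod_self_left]
      exact Int.emod_eq_of_lt h1 (by linarith)
    rw [this]; ring
  · rw [ho.neg_one_zpow]
    obtain ⟨c, hc⟩ := ho
    have : m % (2 * k) = m % k + k := by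
      conv_lhs => rw [← hm, hc, show m % k + k * (2 * c + 1) = m % k + k + (2 * k) * c by ring,
        Int.add_mul_emod_self_left]
      exact Int.emod_eq_of_lt (by linarith) (by linarith)
    rw [this]; push_cast; ring

theorem g_aux_gauss (n : ℕ) :
    ∑ j ∈ Finset.range n, (j : ℚ) = (n : ℚ) * (n - 1) / 2 := by
  induction n with
  | zero => simp
  | succ n ih => rw [Finset.sum_range_succ, ih]; push_cast; ring

theorem g_as_signed_sum (k q i : ℤ) (hk : 0 < k) (hcop : IsCoprime q (2 * k)) :
    g k q i = 1 / 2 * ∑ j ∈ Finset.range k.toNat, (-1 : ℚ) ^ (Int.fdiv (i + q * (j : ℤ)) k) := by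
  have hr := congrArg (fun z : ℤ => (z : ℚ))
    (g_aux_residues k q i hk (hcop.of_mul_right_right))
  simp only [Int.cast_sum, Int.cast_natCast] at hr
  rw [g_aux_gauss] at hr
  have hkn : ((k.toNat : ℕ) : ℚ) = (k : ℚ) := by
    have : ((k.toNat : ℕ) : ℤ) = k := Int.toNat_of_nonneg hk.le
    exact_mod_cast congrArg (fun z : ℤ => (z : ℚ)) this
  have hk0 : (k : ℚ) ≠ 0 := by exact_mod_cast hk.ne'
  unfold g
  simp only [g_aux_term k _ hk]
  rw [Finset.sum_add_distrib, hr, ← Finset.sum_div, ← Finset.mul_sum, Finset.sum_sub_distrib]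
  simp only [Finset.sum_const, Finset.card_range, nsmul_eq_mul, mul_one, hkn]
  field_simp
  ring
end

section
/- Let k be a positive integer and let q be an integer coprime to 2k. Then for every integer i, g(2k, q, i + k) = −g(2k, q, i). -/
theorem sum_residues (N : ℕ) (q i : ℤ) (hN : 0 < N) (hcop : IsCoprime q (N : ℤ)) :
    ∑ j ∈ Finset.range N, (((i + q * (j : ℤ)) % (N : ℤ) : ℤ) : ℚ)
      = ∑ m ∈ Finset.range N, (m : ℚ) := by
  have hN' : (0 : ℤ) < N := by exact_mod_cast hN
  have hnn : ∀ x : ℤ, 0 ≤ x % (N : ℤ) := fun x => Int.emod_nonneg x hN'.ne'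
  have hmaps : ∀ j ∈ Finset.range N,
      ((i + q * (j : ℤ)) % (N : ℤ)).toNat ∈ Finset.range N := by
    intro j _
    have h1 := hnn (i + q * j)
    have h2 := Int.emod_lt_of_pos (i + q * j) hN'
    rw [Finset.mem_range]
    omega
  have hinj : Set.InjOn (fun j : ℕ => ((i + q * (j : ℤ)) % (N : ℤ)).toNat)
      (Finset.range N : Set ℕ) := by
    intro a ha b hb hab
    simp only [Finset.coe_range, Set.mem_Iio] at ha hb
    have h1 := hnn (i + q * a)
    have h2 := hnn (i + q * b)
    have h3 : (i + q * (a : ℤ)) % (N : ℤ) = (i + q * (b : ℤ)) % (N : ℤ) := by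
      simp only at hab
      omega
    have h4 := Int.emod_emod_of_dvd (i + q * (a : ℤ)) (dvd_refl (N : ℤ))
    have h5 : (N : ℤ) ∣ q * ((b : ℤ) - a) := by
      have := (Int.emod_emod_of_dvd (i + q * (a : ℤ)) (dvd_refl (N : ℤ)))
      have h6 := Int.ModEq.dvd (show (i + q * (a : ℤ)) ≡ (i + q * (b : ℤ)) [ZMOD N] from h3)
      have h7 : i + q * (b : ℤ) - (i + q * a) = q * ((b : ℤ) - a) := by ring
      rwa [h7] at h6
    have h8 : (N : ℤ) ∣ (b : ℤ) - a := hcop.symm.dvd_of_dvd_mul_left h5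
    have h9 : (b : ℤ) - a = 0 := Int.eq_zero_of_abs_lt_dvd h8 (by rw [abs_lt]; constructor <;> omega)
    omega
  refine Finset.sum_nbij (fun j : ℕ => ((i + q * (j : ℤ)) % (N : ℤ)).toNat) hmaps hinj
    (Finset.surjOn_of_injOn_of_card_le _ hmaps hinj le_rfl) ?_
  intro j _
  have h1 := hnn (i + q * j)
  have h2 : ((((i + q * (j : ℤ)) % (N : ℤ)).toNat : ℤ) : ℚ)
      = (((i + q * (j : ℤ)) % (N : ℤ) : ℤ) : ℚ) := by rw [Int.toNat_of_nonneg h1]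
  rw [← h2]
  norm_cast

theorem sum_range_rat (N : ℕ) : ∑ m ∈ Finset.range N, (m : ℚ) = N * (N - 1) / 2 := by
  induction N with
  | zero => simp
  | succ n ih => rw [Finset.sum_range_succ, ih]; push_cast; ring

theorem g_antiperiodic (k q : ℤ) (hk : 0 < k) (hcop : IsCoprime q (2 * k)) :
    ∀ i : ℤ, g k q (i + k) = -g k q i := by
  intro i
  lift k to ℕ using hk.le
  have hodd : Odd q := by
    have h : IsCoprime q 2 := hcop.of_mul_right_left
    rw [← Int.not_even_iff_odd, even_iff_two_dvd]
    intro h2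
    have := h.isUnit_of_dvd' h2 dvd_rfl
    rw [Int.isUnit_iff] at this
    omega
  have hk' : 0 < k := by exact_mod_cast hk
  have hS := sum_residues (k + k) q i (by omega)
    (by push_cast; rw [← two_mul]; exact hcop)
  rw [sum_range_rat, Finset.sum_range_add] at hS
  have hshift : ∀ j : ℕ, (i + q * ((k + j : ℕ) : ℤ)) % (2 * (k : ℤ))
      = (i + k + q * (j : ℤ)) % (2 * (k : ℤ)) := by
    intro j
    obtain ⟨r, rfl⟩ := hodd
    have : i + (2 * r + 1) * ((k + j : ℕ) : ℤ)
      = (i + k + (2 * r + 1) * (j : ℤ)) + 2 * k * r := by push_cast; ring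
    rw [this, Int.add_mul_emod_self_left]
  have hc : ((k + k : ℕ) : ℤ) = 2 * (k : ℤ) := by push_cast; ring
  simp only [hc, hshift] at hS
  unfold g
  simp only [Int.toNat_natCast]
  have hkq : (k : ℚ) ≠ 0 := by exact_mod_cast hk'.ne'
  rw [← eq_sub_iff_add_eq'] at hS
  rw [hS]
  push_cast
  field_simp
  ring
end

section
/- Let k be a positive integer and let q be an integer coprime to 2k. Then for every integer i, g(2k, q, i) = g(2k, q, q − 1 − i). -/
theorem g_full_sum (n : ℕ) (q i : ℤ) (hn : 0 < n) (hcop : IsCoprime q (2 * (n : ℤ))) :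
    ∑ j ∈ Finset.range (2 * n), ((i + q * (j : ℤ)) % (2 * n)) = n * (2 * n - 1) := by
  have hinj : Set.InjOn (fun j : ℕ => (i + q * (j : ℤ)) % (2 * n)) (Finset.range (2 * n)) := by
    intro a ha b hb hab
    simp only [Finset.coe_range, Set.mem_Iio] at ha hb
    have h1 : (2 * (n : ℤ)) ∣ q * ((b : ℤ) - a) := by
      have := Int.ModEq.dvd (show (i + q * (a : ℤ)) ≡ (i + q * (b : ℤ)) [ZMOD (2 * n)] from hab)
      convert this using 1
      ring
    have h2 := hcop.symm.dvd_of_dvd_mul_left h1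
    have h3 := Int.eq_zero_of_abs_lt_dvd h2 (by rw [abs_lt]; omega)
    omega
  have himg : (Finset.range (2 * n)).image (fun j : ℕ => (i + q * (j : ℤ)) % (2 * n))
      = (Finset.range (2 * n)).image (fun j : ℕ => (j : ℤ)) := by
    apply Finset.eq_of_subset_of_card_le
    · intro x hx
      obtain ⟨j, -, rfl⟩ := Finset.mem_image.1 hx
      have h0 := Int.emod_nonneg (i + q * (j : ℤ)) (show (2 * (n : ℤ)) ≠ 0 by omega)
      have h1 := Int.emod_lt_of_pos (i + q * (j : ℤ)) (show 0 < (2 * (n : ℤ)) by omega)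
      refine Finset.mem_image.2 ⟨((i + q * (j : ℤ)) % (2 * n)).toNat, ?_, ?_⟩
      · rw [Finset.mem_range]; omega
      · exact Int.toNat_of_nonneg h0
    · rw [Finset.card_image_of_injOn hinj]
      exact Finset.card_image_le
  have hs := Finset.sum_image (f := fun x : ℤ => x) hinj
  rw [← hs, himg, Finset.sum_image (by intro a _ b _ h; exact Int.ofNat.inj h)]
  have hg := Finset.sum_range_id_mul_two (2 * n)
  zify [show 1 ≤ 2 * n by omega] at hg
  linarith

theorem g_emod_refl (m N : ℤ) (hN : 0 < N) : (-1 - m) % N = N - 1 - m % N := by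
  have h0 := Int.emod_nonneg m hN.ne'
  have h1 := Int.emod_lt_of_pos m hN
  rw [← Int.emod_eq_of_lt (show 0 ≤ N - 1 - m % N by omega) (show N - 1 - m % N < N by omega)]
  apply Int.ModEq.symm
  apply (Int.modEq_iff_dvd).2
  refine ⟨-(m / N) - 1, ?_⟩
  have := Int.emod_add_mul_ediv m N
  linarith

theorem g_sum_symm (n : ℕ) (q i : ℤ) (hn : 0 < n) (hcop : IsCoprime q (2 * (n : ℤ))) :
    ∑ j ∈ Finset.range n, ((i + q * (j : ℤ)) % (2 * n)) =
      ∑ j ∈ Finset.range n, ((q - 1 - i + q * (j : ℤ)) % (2 * n)) := by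
  have hf := g_full_sum n q i hn hcop
  rw [two_mul n, Finset.sum_range_add] at hf
  have h2 : ∑ j ∈ Finset.range n, ((q - 1 - i + q * (j : ℤ)) % (2 * n)) =
      ∑ j ∈ Finset.range n, ((2 * (n : ℤ) - 1) - (i + q * ((n + j : ℕ) : ℤ)) % (2 * n)) := by
    rw [← Finset.sum_range_reflect]
    apply Finset.sum_congr rfl
    intro j hj
    rw [Finset.mem_range] at hj
    rw [← g_emod_refl _ _ (by omega)]
    apply (Int.modEq_iff_dvd).2
    refine ⟨-q, ?_⟩
    have : ((n - 1 - j : ℕ) : ℤ) = n - 1 - j := by omega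
    rw [this]
    push_cast
    ring
  rw [h2, Finset.sum_sub_distrib]
  simp only [Finset.sum_const, Finset.card_range, nsmul_eq_mul]
  linarith

theorem g_symmetry (k q : ℤ) (hk : 0 < k) (hcop : IsCoprime q (2 * k)) :
    ∀ i : ℤ, g k q i = g k q (q - 1 - i) := by
  intro i
  obtain ⟨n, rfl⟩ := Int.eq_ofNat_of_zero_le hk.le
  have h := g_sum_symm n q i (by omega) hcop
  unfold g
  rw [Int.toNat_natCast, ← Int.cast_sum, ← Int.cast_sum, h]
end

section
/- Let j and k be relatively prime positive integers of opposite parity, and let i be an integer with 0 ≤ i < j + k. Then g(2j, k − j, i) + g(2k, j − k, i) = 1/2. -/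
lemma aux_cnt (n : ℕ) (c : ℤ) (h0 : 0 ≤ c) (h1 : c ≤ n) :
    ∑ s ∈ Finset.range n, (if (s : ℤ) < c then (1 : ℤ) else 0) = c := by
  induction n generalizing c with
  | zero => simp at *; omega
  | succ n ih =>
    rw [Finset.sum_range_succ]
    by_cases hc : c ≤ n
    · rw [ih c h0 hc, if_neg (by omega)]; simp
    · have hcn : c = n + 1 := by push_cast at h1; omega
      rw [if_pos (by omega)]
      have h2 := ih (n : ℤ) (by omega) le_rfl
      have h3 : ∑ s ∈ Finset.range n, (if (s : ℤ) < c then (1 : ℤ) else 0)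
          = ∑ s ∈ Finset.range n, (if (s : ℤ) < n then (1 : ℤ) else 0) := by
        apply Finset.sum_congr rfl
        intro s hs
        rw [Finset.mem_range] at hs
        rw [if_pos (by omega), if_pos (by omega)]
      rw [h3, h2, hcn]

lemma aux_F (j M : ℕ) (hj : 0 < j) (i : ℤ) (hi0 : 0 ≤ i) (hi : i < 2 * M + 1) :
    ∑ t ∈ Finset.range j, (i + (2 * M + 1) * (t : ℤ)) / (2 * j)
      = ∑ s ∈ Finset.range M, ((j : ℤ) - 1 - (2 * j * (s + 1) - i - 1) / (2 * M + 1)) := by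
  have hj' : (0 : ℤ) < j := by exact_mod_cast hj
  have hN : (0 : ℤ) < 2 * M + 1 := by positivity
  have h1 : ∀ t ∈ Finset.range j, (i + (2 * M + 1) * (t : ℤ)) / (2 * j)
      = ∑ s ∈ Finset.range M, (if 2 * j * ((s : ℤ) + 1) ≤ i + (2 * M + 1) * (t : ℤ)
          then (1 : ℤ) else 0) := by
    intro t ht
    rw [Finset.mem_range] at ht
    have ht' : (t : ℤ) + 1 ≤ j := by exact_mod_cast ht
    rw [← aux_cnt M ((i + (2 * M + 1) * (t : ℤ)) / (2 * j)) (by positivity)]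
    · apply Finset.sum_congr rfl
      intro s _
      have : (s : ℤ) < (i + (2 * M + 1) * (t : ℤ)) / (2 * j) ↔
          2 * j * ((s : ℤ) + 1) ≤ i + (2 * M + 1) * (t : ℤ) := by
        rw [← Int.add_one_le_iff, Int.le_ediv_iff_mul_le (by positivity), mul_comm]
      simp only [this]
    · rw [← Int.lt_add_one_iff, Int.ediv_lt_iff_lt_mul (by positivity)]
      nlinarith
  rw [Finset.sum_congr rfl h1, Finset.sum_comm]
  apply Finset.sum_congr rfl
  intro s hs
  rw [Finset.mem_range] at hs
  have hs' : (s : ℤ) + 1 ≤ M := by exact_mod_cast hs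
  set c := (2 * j * ((s : ℤ) + 1) - i - 1) / (2 * M + 1) with hc
  have hc0 : -1 ≤ c := by
    rw [hc, Int.le_ediv_iff_mul_le hN]
    have : 0 ≤ 2 * j * ((s : ℤ) + 1) := by positivity
    linarith
  have hc1 : c < j := by
    rw [hc, Int.ediv_lt_iff_lt_mul hN]
    nlinarith
  have h2 := aux_cnt j (c + 1) (by omega) (by omega)
  have h3 : ∑ t ∈ Finset.range j, (if 2 * j * ((s : ℤ) + 1) ≤ i + (2 * M + 1) * (t : ℤ)
          then (1 : ℤ) else 0)
      = ∑ t ∈ Finset.range j, (1 - (if (t : ℤ) < c + 1 then (1 : ℤ) else 0)) := by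
    apply Finset.sum_congr rfl
    intro t _
    have : (t : ℤ) < c + 1 ↔ ¬ (2 * j * ((s : ℤ) + 1) ≤ i + (2 * M + 1) * (t : ℤ)) := by
      rw [Int.lt_add_one_iff, hc, Int.le_ediv_iff_mul_le hN, mul_comm (t : ℤ)]
      constructor
      · intro h; linarith
      · intro h; push Not at h; linarith [Int.add_one_le_iff.2 h]
    simp only [this]
    split_ifs <;> simp_all
  rw [h3, Finset.sum_sub_distrib, h2]
  simp
  ring

lemma aux_perm (N : ℕ) (hN : 0 < N) (a b : ℤ) (hc : IsCoprime a (N : ℤ)) :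
    ∑ s ∈ Finset.range N, (a * s + b) % (N : ℤ) = ∑ r ∈ Finset.range N, (r : ℤ) := by
  have hN' : (0 : ℤ) < N := by exact_mod_cast hN
  have hnn : ∀ s : ℕ, 0 ≤ (a * s + b) % (N : ℤ) := fun s => Int.emod_nonneg _ hN'.ne'
  have hlt : ∀ s : ℕ, (a * s + b) % (N : ℤ) < N := fun s => Int.emod_lt_of_pos _ hN'
  have hm : Set.MapsTo (fun s : ℕ => ((a * s + b) % (N : ℤ)).toNat)
      (Finset.range N : Set ℕ) (Finset.range N : Set ℕ) := by
    intro s _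
    simp only [Finset.coe_range, Set.mem_Iio]
    have := hnn s; have := hlt s; omega
  have hinj : Set.InjOn (fun s : ℕ => ((a * s + b) % (N : ℤ)).toNat)
      (Finset.range N : Set ℕ) := by
    intro s hs t ht h
    simp only [Finset.coe_range, Set.mem_Iio] at hs ht h
    have h1 : (a * s + b) % (N : ℤ) = (a * t + b) % (N : ℤ) := by
      have := hnn s; have := hnn t; omega
    have h3 : (N : ℤ) ∣ a * ((t : ℤ) - s) := by
      have h2 := Int.ModEq.dvd h1
      have e : a * ((t : ℤ) - s) = a * t + b - (a * s + b) := by ring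
      rw [e]; exact h2
    have h4 : (N : ℤ) ∣ (t : ℤ) - s := hc.symm.dvd_of_dvd_mul_left h3
    have h5 := Int.eq_zero_of_abs_lt_dvd h4 (by rw [abs_lt]; omega)
    omega
  refine Finset.sum_nbij (fun s : ℕ => ((a * s + b) % (N : ℤ)).toNat) hm hinj
    (Finset.surjOn_of_injOn_of_card_le _ hm hinj le_rfl) ?_
  intro s _
  have := hnn s
  show (a * s + b) % (N : ℤ) = (((a * s + b) % (N : ℤ)).toNat : ℤ)
  omega

lemma aux_D (M : ℕ) (a i : ℤ) (hc : IsCoprime a ((2 * M + 1 : ℕ) : ℤ)) (hi0 : 0 ≤ i)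
    (hi : i < 2 * M + 1) :
    ∑ s ∈ Finset.range M, ((a * ((s : ℤ) + 1) + i) / (2 * M + 1)
      - (a * ((s : ℤ) + 1) - i - 1) / (2 * M + 1)) = i := by
  have hN : (0 : ℤ) < 2 * M + 1 := by positivity
  set D : ℕ → ℤ := fun s => (a * (s : ℤ) + i) / (2 * M + 1)
      - (a * (s : ℤ) - i - 1) / (2 * M + 1) with hD
  have htot : ∑ s ∈ Finset.range (2 * M + 1), D s = 2 * i + 1 := by
    have p1 := aux_perm (2 * M + 1) (by omega) a i hc
    have p2 := aux_perm (2 * M + 1) (by omega) a (-i - 1) hc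
    have p3 : ∑ s ∈ Finset.range (2 * M + 1), ((2 * M + 1 : ℤ) * D s)
        = ∑ s ∈ Finset.range (2 * M + 1), ((2 * i + 1)
          - ((a * s + i) % ((2 * M + 1 : ℕ) : ℤ) - (a * s + (-i - 1)) % ((2 * M + 1 : ℕ) : ℤ))) := by
      apply Finset.sum_congr rfl
      intro s _
      simp only [hD]
      push_cast
      have e1 := Int.mul_ediv_add_emod (a * s + i) (2 * M + 1)
      have e2 := Int.mul_ediv_add_emod (a * s + (-i - 1)) (2 * M + 1)
      have e3 : a * (s : ℤ) - i - 1 = a * s + (-i - 1) := by ring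
      rw [e3]
      linarith
    rw [← Finset.mul_sum, Finset.sum_sub_distrib (fun _ => 2 * i + 1),
      Finset.sum_sub_distrib (fun s : ℕ => (a * s + i) % ((2 * M + 1 : ℕ) : ℤ)), p1, p2] at p3
    simp only [Finset.sum_const, Finset.card_range, nsmul_eq_mul, sub_self, sub_zero] at p3
    push_cast at p3
    exact mul_left_cancel₀ hN.ne' p3
  have hD0 : D 0 = 1 := by
    simp only [hD]
    have e1 : (a * ((0 : ℕ) : ℤ) + i) / (2 * M + 1) = 0 := by
      apply Int.ediv_eq_zero_of_lt <;> simp <;> omega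
    have e2 : (a * ((0 : ℕ) : ℤ) - i - 1) / (2 * M + 1) = -1 := by
      apply le_antisymm
      · rw [← Int.lt_add_one_iff, Int.ediv_lt_iff_lt_mul hN]; simp; omega
      · rw [Int.le_ediv_iff_mul_le hN]; simp; omega
    rw [e1, e2]; norm_num
  have hneg : ∀ y : ℤ, (-y - 1) / (2 * M + 1 : ℤ) = - (y / (2 * M + 1)) - 1 := by
    intro y
    have e1 := Int.mul_ediv_add_emod y (2 * M + 1)
    have e2 := Int.emod_nonneg y hN.ne'
    have e3 := Int.emod_lt_of_pos y hN
    apply le_antisymm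
    · rw [← Int.lt_add_one_iff, Int.ediv_lt_iff_lt_mul hN]; linarith
    · rw [Int.le_ediv_iff_mul_le hN]; linarith
  have hsymm : ∀ s < M, D (M + (M - 1 - s) + 1) = D (s + 1) := by
    intro s hs
    simp only [hD]
    have ec : ((M + (M - 1 - s) + 1 : ℕ) : ℤ) = 2 * M + 1 - (s + 1) := by omega
    rw [ec]
    have e1 : a * (2 * (M : ℤ) + 1 - (s + 1)) + i
        = (-(a * ((s : ℤ) + 1) - i - 1) - 1) + (2 * M + 1) * a := by ring
    have e2 : a * (2 * (M : ℤ) + 1 - (s + 1)) - i - 1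
        = (-(a * ((s : ℤ) + 1) + i) - 1) + (2 * M + 1) * a := by ring
    rw [e1, e2, Int.add_mul_ediv_left _ _ hN.ne', Int.add_mul_ediv_left _ _ hN.ne', hneg, hneg]
    push_cast
    ring
  rw [Finset.sum_range_succ', hD0, two_mul, Finset.sum_range_add,
    ← Finset.sum_range_reflect (fun x => D (M + x + 1)) M,
    Finset.sum_congr rfl (fun s hs => hsymm s (Finset.mem_range.1 hs))] at htot
  have : ∑ s ∈ Finset.range M, D (s + 1) = i := by linarith
  simpa [hD] using this

lemma aux_g' (j : ℕ) (hj : 0 < j) (q N i : ℤ) (h : N = q + 2 * j) :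
    g j q i = (2 * (j : ℚ) - 1) / 2 - i - N * (j - 1) / 2
      + 2 * ((∑ t ∈ Finset.range j, (i + N * (t : ℤ)) / (2 * j) : ℤ) : ℚ) := by
  have hj' : (j : ℚ) ≠ 0 := by positivity
  have e1 : ∀ t : ℕ, (i + q * (t : ℤ)) % (2 * j)
      = (i + N * t) - 2 * j * ((i + N * (t : ℤ)) / (2 * j)) := by
    intro t
    have : i + N * (t : ℤ) = i + q * t + 2 * j * t := by rw [h]; ring
    rw [← Int.emod_def, this, Int.add_mul_emod_self_left]
  have e2 : ∀ n : ℕ, ∑ t ∈ Finset.range n, ((i : ℚ) + N * (t : ℚ)) = n * i + N * (n * (n - 1) / 2) := by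
    intro n
    induction n with
    | zero => simp
    | succ n ih => rw [Finset.sum_range_succ, ih]; push_cast; ring
  unfold g
  simp only [Int.toNat_natCast, e1]
  push_cast
  rw [Finset.sum_sub_distrib, e2, ← Finset.mul_sum]
  field_simp
  ring

theorem g_reciprocity (j k : ℤ) (hj : 0 < j) (hk : 0 < k) (hcop : IsCoprime j k)
    (hpar : Odd (j + k)) (i : ℤ) (hi0 : 0 ≤ i) (hi : i < j + k) :
    g j (k - j) i + g k (j - k) i = 1 / 2 := by
  obtain ⟨m, hm⟩ := hpar
  lift j to ℕ using hj.le
  lift k to ℕ using hk.le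
  lift m to ℕ using (by omega) with M
  have hj' : 0 < j := by exact_mod_cast hj
  have hk' : 0 < k := by exact_mod_cast hk
  have hN : (0 : ℤ) < 2 * M + 1 := by positivity
  rw [aux_g' j hj' _ (2 * M + 1) i (by linarith), aux_g' k hk' _ (2 * M + 1) i (by linarith),
    aux_F j M hj' i hi0 (by linarith), aux_F k M hk' i hi0 (by linarith)]
  have hc : IsCoprime (2 * (j : ℤ)) ((2 * M + 1 : ℕ) : ℤ) := by
    push_cast
    apply IsCoprime.mul_left
    · exact ⟨-M, 1, by ring⟩
    · rw [← hm, add_comm]; simpa using hcop.add_mul_left_right 1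
  have hd := aux_D M (2 * j) i hc hi0 (by linarith)
  have hneg : ∀ y : ℤ, (-y - 1) / (2 * M + 1 : ℤ) = - (y / (2 * M + 1)) - 1 := by
    intro y
    have e1 := Int.mul_ediv_add_emod y (2 * M + 1)
    have e2 := Int.emod_nonneg y hN.ne'
    have e3 := Int.emod_lt_of_pos y hN
    apply le_antisymm
    · rw [← Int.lt_add_one_iff, Int.ediv_lt_iff_lt_mul hN]; linarith
    · rw [Int.le_ediv_iff_mul_le hN]; linarith
  have hs : ∀ n : ℕ, ∑ s ∈ Finset.range n, ((2 * M : ℤ) - 2 * ((s : ℤ) + 1)) = 2 * M * n - n * (n + 1) := by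
    intro n
    induction n with
    | zero => simp
    | succ n ih => rw [Finset.sum_range_succ, ih]; push_cast; ring
  have key : ∑ s ∈ Finset.range M, ((j : ℤ) - 1 - (2 * j * (s + 1) - i - 1) / (2 * M + 1))
      + ∑ s ∈ Finset.range M, ((k : ℤ) - 1 - (2 * k * (s + 1) - i - 1) / (2 * M + 1))
      = i + (2 * M * M - M * (M + 1)) := by
    rw [← hs M, ← Finset.sum_add_distrib]
    conv_rhs => rw [← hd]
    rw [← Finset.sum_add_distrib]
    apply Finset.sum_congr rfl
    intro s _
    have e : 2 * (k : ℤ) * (s + 1) - i - 1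
        = (-(2 * j * ((s : ℤ) + 1) + i) - 1) + (2 * M + 1) * (2 * (s + 1)) := by
      rw [← hm]; ring
    rw [e, Int.add_mul_ediv_left _ _ hN.ne', hneg]
    linarith
  have keyQ := congrArg (fun z : ℤ => (z : ℚ)) key
  have hmQ : (j : ℚ) + k = 2 * M + 1 := by exact_mod_cast hm
  simp only [Int.cast_add] at keyQ
  generalize ((∑ s ∈ Finset.range M, ((j : ℤ) - 1 - (2 * j * (s + 1) - i - 1) / (2 * M + 1)) : ℤ) : ℚ) = A at *
  generalize ((∑ s ∈ Finset.range M, ((k : ℤ) - 1 - (2 * k * (s + 1) - i - 1) / (2 * M + 1)) : ℤ) : ℚ) = B at *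
  push_cast at keyQ ⊢
  have hkQ : (k : ℚ) = 2 * M + 1 - j := by linarith
  have hB : B = i + (2 * M * M - M * (M + 1)) - A := by linarith
  rw [hkQ, hB]
  ring
end

section
/- Let k be a positive integer, let q be an integer with k + q > 0, and let i be an integer with −k ≤ i < k + q. Then in the ring ℤ[u, u⁻¹] of Laurent polynomials, (1 − u) · (P(2k+2q, q, i) − P(2k, q, i)) = 1 − u^q. -/
open LaurentPolynomial

/-- `P (2k, q, i) = ∑_{j=0}^{k-1} u^{⌊(i + q j)/k⌋}` as a Laurent polynomial in `u = T 1`. -/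
noncomputable def P (k q i : ℤ) : LaurentPolynomial ℤ :=
  ∑ j ∈ Finset.range k.toNat, T (Int.fdiv (i + q * (j : ℤ)) k)

lemma fdiv_eq_of_rem (a k c r : ℤ) (hr : 0 ≤ r) (hrk : r < k) (h : a = k * c + r) :
    Int.fdiv a k = c := by
  rw [Int.fdiv_eq_ediv_of_nonneg _ (by omega), h, Int.add_comm, Int.add_mul_ediv_left _ _ (by omega),
    Int.ediv_eq_zero_of_lt hr hrk, zero_add]

lemma one_sub_T_mul (a : ℤ) : (1 - T 1 : LaurentPolynomial ℤ) * T a = T a - T (a + 1) := by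
  rw [sub_mul, one_mul, ← T_add, add_comm 1 a]

/-- The lattice walk: after `n` steps, `x` horizontal and `y` vertical ones were made. -/
lemma walk (k q i : ℤ) (hi1 : -k ≤ i) (hi2 : i < k + q) (hk : 0 < k) (hkq : 0 < k + q) (n : ℕ) :
    ∃ x y : ℕ, x + y = n ∧ 0 ≤ (k + q) * y - k * x + i + k ∧
      (k + q) * y - k * x + i + k < (k + q) + k ∧
      (1 - T 1 : LaurentPolynomial ℤ) *
        (∑ j ∈ Finset.range x, T (Int.fdiv (i + q * (j : ℤ)) (k + q)) -
          ∑ j ∈ Finset.range y, T (Int.fdiv (i + q * (j : ℤ)) k)) = 1 - T ((x : ℤ) - y) := by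
  induction n with
  | zero => exact ⟨0, 0, rfl, by simp; omega, by simp; omega, by simp⟩
  | succ n ih =>
    obtain ⟨x, y, hn, h0, h1, h⟩ := ih
    by_cases hL : k ≤ (k + q) * y - k * x + i + k
    · refine ⟨x + 1, y, by omega, ?_, ?_, ?_⟩
      · push_cast; linarith
      · push_cast; linarith
      · have e : Int.fdiv (i + q * (x : ℤ)) (k + q) = (x : ℤ) - y :=
          fdiv_eq_of_rem _ _ _ ((k + q) * y - k * x + i) (by linarith) (by linarith) (by ring)
        have t := one_sub_T_mul ((x : ℤ) - y)
        have e2 : ((x + 1 : ℕ) : ℤ) - y = (x : ℤ) - y + 1 := by push_cast; ring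
        rw [Finset.sum_range_succ, e, e2]
        linear_combination h + t
    · refine ⟨x, y + 1, by omega, ?_, ?_, ?_⟩
      · push_cast; linarith
      · push_cast; linarith
      · have e : Int.fdiv (i + q * (y : ℤ)) k = (x : ℤ) - y - 1 :=
          fdiv_eq_of_rem _ _ _ ((k + q) * y - k * x + i + k) (by linarith) (by linarith) (by ring)
        have t := one_sub_T_mul ((x : ℤ) - y - 1)
        rw [sub_add_cancel] at t
        have e2 : (x : ℤ) - (y + 1 : ℕ) = (x : ℤ) - y - 1 := by push_cast; ring
        rw [Finset.sum_range_succ, e, e2]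
        linear_combination h - t

theorem P_rec (k q i : ℤ) (hk : 0 < k) (hkq : 0 < k + q) (hi1 : -k ≤ i) (hi2 : i < k + q) :
    (1 - T 1) * (P (k + q) q i - P k q i) = 1 - T q := by
  obtain ⟨x, y, hn, h0, h1, h⟩ := walk k q i hi1 hi2 hk hkq (k + q + k).toNat
  have hx : (x : ℤ) = k + q + k - y := by omega
  rw [hx] at h0 h1
  have hy : (y : ℤ) = k := by
    have a : (y : ℤ) - k < 1 := by
      by_contra hc
      nlinarith
    have b : -1 < (y : ℤ) - k := by
      by_contra hc
      nlinarith
    omega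
  have hx' : x = (k + q).toNat := by omega
  have hy' : y = k.toNat := by omega
  have e : (x : ℤ) - y = q := by omega
  rw [e, hx', hy'] at h
  exact h
end

section
/- Let j and k be positive integers and let i be an integer with 0 ≤ i < j + k. Then in the ring ℤ[u, u⁻¹] of Laurent polynomials, (1 − u) · (u^{j−1}·Q(j, k, i) − u^{k−1}·Q(k, j, i)) = u^k − u^j. -/
open LaurentPolynomial

/-- `Q (k, j, i) = ∑_{l=0}^{k-1} u^{⌊(i + j l)/k⌋ - l}` as a Laurent polynomial in `u = T 1`. -/
noncomputable def Q (k j i : ℤ) : LaurentPolynomial ℤ :=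
  ∑ l ∈ Finset.range k.toNat, T (Int.fdiv (i + j * (l : ℤ)) k - l)

theorem Q_walk (j k i : ℤ) (hj : 0 < j) (hk : 0 < k) (hi0 : 0 ≤ i) (hi : i < j + k) (n : ℕ) :
    ∃ a b : ℕ, a + b = n ∧ 0 ≤ i + j * a - k * b ∧ i + j * a - k * b < j + k ∧
      (T ((b : ℤ) - a) - 1 : LaurentPolynomial ℤ) = (T 1 - 1) *
        (∑ m ∈ Finset.range b, T (m - k + Int.fdiv (i + k * (j - 1 - (m : ℤ))) j)
          - T (-1) * ∑ l ∈ Finset.range a, T (Int.fdiv (i + j * (l : ℤ)) k - l)) := by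
  induction n with
  | zero => exact ⟨0, 0, rfl, by simpa using hi0, by simpa using hi, by simp⟩
  | succ n ih =>
    obtain ⟨a, b, hab, h0, h1, h⟩ := ih
    by_cases hx : i + j * a - k * b < k
    · refine ⟨a + 1, b, by omega, by push_cast; linarith, by push_cast; linarith, ?_⟩
      have hf : Int.fdiv (i + j * (a : ℤ)) k = b := by
        rw [Int.fdiv_eq_ediv_of_nonneg _ hk.le]
        refine le_antisymm (Int.lt_add_one_iff.1 ((Int.ediv_lt_iff_lt_mul (by assumption)).2 ?_)) ((Int.le_ediv_iff_mul_le (by assumption)).2 ?_) <;> nlinarith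
      rw [Finset.sum_range_succ, hf]
      have e : (T ((b : ℤ) - (a + 1 : ℕ)) : LaurentPolynomial ℤ) = T (-1) * T ((b : ℤ) - a) := by
        rw [← T_add]; congr 1; push_cast; ring
      have e1 : (T 1 * T (-1) : LaurentPolynomial ℤ) = 1 := by
        rw [← T_add]; simp
      rw [e]
      linear_combination h + T ((b : ℤ) - a) * e1
    · refine ⟨a, b + 1, by omega, by push_cast; linarith, by push_cast; linarith, ?_⟩
      have hf : Int.fdiv (i + k * (j - 1 - (b : ℤ))) j = k - a := by
        rw [Int.fdiv_eq_ediv_of_nonneg _ hj.le]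
        refine le_antisymm (Int.lt_add_one_iff.1 ((Int.ediv_lt_iff_lt_mul (by assumption)).2 ?_)) ((Int.le_ediv_iff_mul_le (by assumption)).2 ?_) <;> nlinarith
      rw [Finset.sum_range_succ, hf]
      have e : (T (((b + 1 : ℕ) : ℤ) - a) : LaurentPolynomial ℤ) = T 1 * T ((b : ℤ) - a) := by
        rw [← T_add]; congr 1; push_cast; ring
      have e2 : (b : ℤ) - k + (k - a) = b - a := by ring
      rw [e, e2]
      linear_combination h

theorem Q_reciprocity (j k i : ℤ) (hj : 0 < j) (hk : 0 < k) (hi0 : 0 ≤ i) (hi : i < j + k) :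
    (1 - T 1) * (T (j - 1) * Q j k i - T (k - 1) * Q k j i) = T k - T j := by
  obtain ⟨a, b, hab, h0, h1, h⟩ := Q_walk j k i hj hk hi0 hi (j + k).toNat
  have hs : (a : ℤ) + b = j + k := by omega
  have hb : (b : ℤ) = j + k - a := by omega
  have hx : i + j * a - k * b = i + (j + k) * (a - k) := by rw [hb]; ring
  rw [hx] at h0 h1
  have ha : (a : ℤ) = k := by
    rcases lt_trichotomy (a : ℤ) k with h' | h' | h'
    · nlinarith
    · exact h'
    · nlinarith
  have hb' : (b : ℤ) = j := by omega
  have ea : k.toNat = a := by omega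
  have eb : j.toNat = b := by omega
  have hD : T k * ∑ m ∈ Finset.range b, T (m - k + Int.fdiv (i + k * (j - 1 - (m : ℤ))) j)
      = T (j - 1) * Q j k i := by
    unfold Q
    rw [eb, Finset.mul_sum, Finset.mul_sum, ← Finset.sum_range_reflect]
    refine Finset.sum_congr rfl fun m hm => ?_
    have hm' := Finset.mem_range.1 hm
    have hc : ((b - 1 - m : ℕ) : ℤ) = j - 1 - m := by omega
    rw [hc, ← T_add, ← T_add]
    have : j - 1 - (j - 1 - (m : ℤ)) = m := by ring
    rw [this]
    congr 1
    ring
  have hU : ∑ l ∈ Finset.range a, T (Int.fdiv (i + j * (l : ℤ)) k - l) = Q k j i := by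
    unfold Q; rw [ea]
  rw [hU, ha, hb'] at h
  have e1 : (T k * T (j - k) : LaurentPolynomial ℤ) = T j := by
    rw [← T_add]; congr 1; ring
  have e2 : (T k * T (-1) : LaurentPolynomial ℤ) = T (k - 1) := by
    rw [← T_add]; congr 1
  rw [← hD, ← e2, ← e1]
  linear_combination T k * h
end
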